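/- arXiv:2605.13124 — 6 statements merged into one kernel-verified Lean document; each statement's English description precedes it below -/
import Mathlib

section
/- Let N, R, M be natural numbers, let V be a real N×R matrix with rank(V) = R, and let B be a real M×R matrix with rank(B) = M. Then the symmetric (R+M)×(R+M) block matrix K = [[VᵀV, Bᵀ], [B, 0]] has exactly R positive eigenvalues and exactly M negative eigenvalues, counted with multiplicity. -/
open Matrix Polynomial

section Inertia

variable {m n : Type*} [Fintype m] [Fintype n] [DecidableEq n]

/-- The quadratic form of a real symmetric matrix in eigenvector coordinates. -/
lemma Matrix.IsHermitian.dotProduct_mulVec_eq_sum_eigenvalues {A : Matrix n n ℝ}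
    (hA : A.IsHermitian) (x : n → ℝ) :
    x ⬝ᵥ A *ᵥ x =
      ∑ i, hA.eigenvalues i * ((hA.eigenvectorUnitary : Matrix n n ℝ)ᵀ *ᵥ x) i ^ 2 := by
  conv_lhs => rw [hA.spectral_theorem, Unitary.conjStarAlgAut_apply]
  rw [← mulVec_mulVec, ← mulVec_mulVec, dotProduct_mulVec, ← mulVec_transpose]
  simp only [dotProduct, mulVec_diagonal, star_eq_conjTranspose,
    conjTranspose_eq_transpose_of_trivial, Function.comp_apply, RCLike.ofReal_real_eq_id, id_eq]
  exact Finset.sum_congr rfl fun i _ => by ring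

/-- If `s` times the quadratic form of `A` is positive definite along a linear map from `ℝᵐ`,
then at least `m` eigenvalues of `A` have the sign of `s`. -/
lemma Matrix.IsHermitian.card_le_card_eigenvalues_of_pos {A : Matrix n n ℝ}
    (hA : A.IsHermitian) (s : ℝ) (L : (m → ℝ) →ₗ[ℝ] (n → ℝ))
    (hL : ∀ w, w ≠ 0 → 0 < s * (L w ⬝ᵥ A *ᵥ L w)) :
    Fintype.card m ≤ (Finset.univ.filter fun i => 0 < s * hA.eigenvalues i).card := by
  let T : (m → ℝ) →ₗ[ℝ] ({i // 0 < s * hA.eigenvalues i} → ℝ) :=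
    (LinearMap.funLeft ℝ ℝ Subtype.val).comp
      ((mulVecLin (hA.eigenvectorUnitary : Matrix n n ℝ)ᵀ).comp L)
  have hT : Function.Injective T := by
    rw [← LinearMap.ker_eq_bot, LinearMap.ker_eq_bot']
    intro w hw
    by_contra hne
    have hpos := hL w hne
    rw [hA.dotProduct_mulVec_eq_sum_eigenvalues, Finset.mul_sum] at hpos
    refine hpos.not_ge (Finset.sum_nonpos fun i _ => ?_)
    rw [← mul_assoc]
    by_cases hi : 0 < s * hA.eigenvalues i
    · have hz : ((hA.eigenvectorUnitary : Matrix n n ℝ)ᵀ *ᵥ L w) i = 0 := congrFun hw ⟨i, hi⟩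
      simp [hz]
    · exact mul_nonpos_of_nonpos_of_nonneg (not_lt.mp hi) (sq_nonneg _)
  have h := LinearMap.finrank_le_finrank_of_injective hT
  simpa [Fintype.card_subtype] using h

lemma Matrix.IsHermitian.card_filter_roots_charpoly {A : Matrix n n ℝ} (hA : A.IsHermitian)
    (p : ℝ → Prop) [DecidablePred p] :
    (A.charpoly.roots.filter p).card = (Finset.univ.filter fun i => p (hA.eigenvalues i)).card := by
  rw [hA.roots_charpoly_eq_eigenvalues, Multiset.filter_map, Multiset.card_map]
  rfl

end Inertia

lemma Matrix.mulVec_injective_of_rank_eq_card {m n : Type*} [Fintype m] [Fintype n]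
    {A : Matrix m n ℝ} (hA : A.rank = Fintype.card n) : Function.Injective A.mulVec := by
  rw [mulVec_injective_iff, linearIndependent_iff_card_eq_finrank_span, ← hA,
    rank_eq_finrank_span_cols]
  rfl

lemma Matrix.dotProduct_fromBlocks_mulVec {m n : Type*} [Fintype m] [Fintype n]
    (G : Matrix n n ℝ) (B : Matrix m n ℝ) (x : n → ℝ) (y : m → ℝ) :
    Sum.elim x y ⬝ᵥ fromBlocks G Bᵀ B 0 *ᵥ Sum.elim x y =
      x ⬝ᵥ G *ᵥ x + 2 * (x ⬝ᵥ Bᵀ *ᵥ y) := by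
  have h : y ⬝ᵥ B *ᵥ x = x ⬝ᵥ Bᵀ *ᵥ y := by
    rw [dotProduct_mulVec, mulVec_transpose, dotProduct_comm]
  simp only [fromBlocks_mulVec, sumElim_dotProduct_sumElim, Sum.elim_comp_inl, Sum.elim_comp_inr,
    zero_mulVec, add_zero, dotProduct_add, h]
  ring

/-- If `V : ℝ^{N×R}` has rank `R` and `B : ℝ^{M×R}` has rank `M`,
then the symmetric KKT block matrix `K = [[VᵀV, Bᵀ], [B, 0]]` has exactly `R` positive
eigenvalues and exactly `M` negative eigenvalues, counted with multiplicity (i.e. as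
roots of its characteristic polynomial). -/
theorem kkt_inertia (N R M : ℕ)
    (V : Matrix (Fin N) (Fin R) ℝ) (B : Matrix (Fin M) (Fin R) ℝ)
    (hV : V.rank = R) (hB : B.rank = M) :
    (((Matrix.fromBlocks (Vᵀ * V) Bᵀ B (0 : Matrix (Fin M) (Fin M) ℝ)).charpoly.roots.filter
        (fun x => 0 < x)).card = R) ∧
    (((Matrix.fromBlocks (Vᵀ * V) Bᵀ B (0 : Matrix (Fin M) (Fin M) ℝ)).charpoly.roots.filter
        (fun x => x < 0)).card = M) := by
  have hVinj : Function.Injective V.mulVec := mulVec_injective_of_rank_eq_card (by simpa using hV)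
  have hBinj : Function.Injective Bᵀ.mulVec :=
    mulVec_injective_of_rank_eq_card (by simpa [rank_transpose] using hB)
  have hG : (Vᵀ * V).PosDef := by
    simpa using PosDef.conjTranspose_mul_self V hVinj
  have hGpos : ∀ x, x ≠ 0 → 0 < x ⬝ᵥ (Vᵀ * V) *ᵥ x := fun x hx => by
    simpa using hG.dotProduct_mulVec_pos hx
  have hK : (fromBlocks (Vᵀ * V) Bᵀ B (0 : Matrix (Fin M) (Fin M) ℝ)).IsHermitian :=
    IsHermitian.fromBlocks hG.isHermitian (by simp) isHermitian_zero
  rw [hK.card_filter_roots_charpoly, hK.card_filter_roots_charpoly]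
  have hpos := hK.card_le_card_eigenvalues_of_pos 1
    (m := Fin R) ((LinearEquiv.sumArrowLequivProdArrow (Fin R) (Fin M) ℝ ℝ).symm.toLinearMap.comp
      (LinearMap.inl ℝ (Fin R → ℝ) (Fin M → ℝ))) fun x hx => by
    have hform := dotProduct_fromBlocks_mulVec (Vᵀ * V) B x 0
    rw [mulVec_zero, dotProduct_zero, mul_zero, add_zero] at hform
    rw [one_mul]
    exact (hGpos x hx).trans_eq hform.symm
  have hneg := hK.card_le_card_eigenvalues_of_pos (-1)
    (m := Fin M) ((LinearEquiv.sumArrowLequivProdArrow (Fin R) (Fin M) ℝ ℝ).symm.toLinearMap.comp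
      ((mulVecLin (-((Vᵀ * V)⁻¹ * Bᵀ))).prod LinearMap.id)) fun y hy => by
    have hform := dotProduct_fromBlocks_mulVec (Vᵀ * V) B (-((Vᵀ * V)⁻¹ * Bᵀ) *ᵥ y) y
    set x := -((Vᵀ * V)⁻¹ * Bᵀ) *ᵥ y with hx
    have hstat : Bᵀ *ᵥ y = -((Vᵀ * V) *ᵥ x) := by
      rw [hx, mulVec_mulVec, Matrix.mul_neg,
        mul_nonsing_inv_cancel_left _ _ ((isUnit_iff_isUnit_det _).mp hG.isUnit), neg_mulVec,
        neg_neg]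
    have hx0 : x ≠ 0 := fun h0 => hy (hBinj (by simp [hstat, h0]))
    rw [hstat, dotProduct_neg] at hform
    refine lt_of_lt_of_eq (hGpos x hx0) (Eq.symm ?_)
    refine (congrArg (-1 * ·) hform).trans ?_
    ring
  simp only [one_mul, neg_mul, neg_pos, Fintype.card_fin] at hpos hneg
  have hdisj : Disjoint (Finset.univ.filter fun i => 0 < hK.eigenvalues i)
      (Finset.univ.filter fun i => hK.eigenvalues i < 0) :=
    Finset.disjoint_filter.mpr fun i _ h => h.le.not_gt
  have htotal := Finset.card_le_univ (Finset.disjUnion _ _ hdisj)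
  rw [Finset.card_disjUnion, Fintype.card_sum, Fintype.card_fin, Fintype.card_fin] at htotal
  omega
end

section
/- Let X_N be a finite set of N points on the unit sphere S² ⊂ ℝ³ such that the only polynomial in Π_r(S²) vanishing at every point of X_N is the zero function, let X_M ⊆ X_N, and let f : S² → ℝ. Suppose p ∈ Π_r(S²) satisfies p(x) = f(x) for all x ∈ X_M and ⟨p − f, q⟩_{X_N} = 0 for every q ∈ Π_r(S²) vanishing on X_M, and suppose p̂ ∈ Π_r(S²) satisfies the same two properties. Then p = p̂ (as functions on S²). -/
open Finset

noncomputable section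

/-- The unit sphere `S² = {x ∈ ℝ³ : ‖x‖ = 1}` (described via `∑ i, x i ^ 2 = 1`). -/
def S2 : Set (Fin 3 → ℝ) := {x | ∑ i, x i ^ 2 = 1}

/-- `PiSph r` : the space `Π_r(S²)` of restrictions to `S²` of real polynomials in
three variables of total degree at most `r` (represented by functions on `ℝ³` that
agree with such a polynomial on `S²`). -/
def PiSph (r : ℕ) : Set ((Fin 3 → ℝ) → ℝ) :=
  {p | ∃ P : MvPolynomial (Fin 3) ℝ, P.totalDegree ≤ r ∧ ∀ x ∈ S2, p x = MvPolynomial.eval x P}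

theorem PiSph_sub {r : ℕ} {p q : (Fin 3 → ℝ) → ℝ} (hp : p ∈ PiSph r) (hq : q ∈ PiSph r) :
    p - q ∈ PiSph r := by
  obtain ⟨P, hP, hpP⟩ := hp
  obtain ⟨Q, hQ, hqQ⟩ := hq
  exact ⟨P - Q, (MvPolynomial.totalDegree_sub P Q).trans (max_le hP hQ), fun x hx => by
    simp [hpP x hx, hqQ x hx]⟩

/-- If the only element of `Π_r(S²)` vanishing on all of `X_N` is the zero
function, then an element of `Π_r(S²)` interpolating `f` on `X_M` whose residual is orthogonal
(w.r.t. the discrete inner product on `X_N`) to all `q ∈ Π_r(S²)` vanishing on `X_M` is unique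
as a function on `S²`. -/
theorem orthogonal_characterization_unique (N : ℕ) (XN XM : Finset (Fin 3 → ℝ))
    (hXN : ↑XN ⊆ S2) (hcard : XN.card = N) (hXM : XM ⊆ XN)
    (r : ℕ)
    (huni : ∀ q ∈ PiSph r, (∀ x ∈ XN, q x = 0) → ∀ x ∈ S2, q x = 0)
    (f p phat : (Fin 3 → ℝ) → ℝ)
    (hp : p ∈ PiSph r)
    (hpinterp : ∀ x ∈ XM, p x = f x)
    (hporth : ∀ q ∈ PiSph r, (∀ x ∈ XM, q x = 0) →
      ∑ x ∈ XN, (p x - f x) * q x = 0)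
    (hphat : phat ∈ PiSph r)
    (hphatinterp : ∀ x ∈ XM, phat x = f x)
    (hphatorth : ∀ q ∈ PiSph r, (∀ x ∈ XM, q x = 0) →
      ∑ x ∈ XN, (phat x - f x) * q x = 0) :
    ∀ x ∈ S2, p x = phat x := by
  have hmem : p - phat ∈ PiSph r := PiSph_sub hp hphat
  have hvanish : ∀ x ∈ XM, (p - phat) x = 0 := fun x hx => by
    simp [hpinterp x hx, hphatinterp x hx]
  have hsq : ∑ x ∈ XN, (p - phat) x * (p - phat) x = 0 := by
    rw [← sub_eq_zero_of_eq ((hporth _ hmem hvanish).trans (hphatorth _ hmem hvanish).symm),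
      ← sum_sub_distrib]
    refine sum_congr rfl fun x _ => ?_
    simp only [Pi.sub_apply]
    ring
  have hzero : ∀ x ∈ XN, (p - phat) x = 0 := fun x hx =>
    mul_self_eq_zero.mp ((sum_eq_zero_iff_of_nonneg fun y _ => mul_self_nonneg _).mp hsq x hx)
  exact fun x hx => sub_eq_zero.mp (huni _ hmem hzero x hx)
end
end

section
/- Let X_N be a finite antipodally symmetric set of points on the unit sphere S² ⊂ ℝ³, let X_M ⊆ X_N also be antipodally symmetric, let r be a natural number, and let f : S² → ℝ. Write f⁺, f⁻ for the even and odd parts of f. Suppose p⁺ ∈ Π_r⁺(S²) satisfies p⁺ = f⁺ on X_M and minimizes ∑_{x ∈ X_N} |p(x) − f⁺(x)|² over all p ∈ Π_r⁺(S²) satisfying p = f⁺ on X_M, and suppose p⁻ ∈ Π_r⁻(S²) satisfies p⁻ = f⁻ on X_M and minimizes ∑_{x ∈ X_N} |p(x) − f⁻(x)|² over all p ∈ Π_r⁻(S²) satisfying p = f⁻ on X_M. Then the sum p⁺ + p⁻ satisfies p⁺ + p⁻ = f on X_M and minimizes ∑_{x ∈ X_N} |p(x) − f(x)|² over all p ∈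 Π_r(S²) satisfying p = f on X_M. -/
open Finset

noncomputable section

/-- A polynomial function precomposed with negation is a polynomial function of no larger degree. -/
theorem MvPolynomial.exists_eval_neg {σ R : Type*} [CommRing R] (P : MvPolynomial σ R) :
    ∃ Q : MvPolynomial σ R, Q.totalDegree ≤ P.totalDegree ∧
      ∀ x : σ → R, MvPolynomial.eval x Q = MvPolynomial.eval (-x) P := by
  classical
  refine ⟨MvPolynomial.bind₁ (fun i => -MvPolynomial.X i) P, ?_, fun x => ?_⟩
  · rw [MvPolynomial.bind₁, MvPolynomial.aeval_def, MvPolynomial.eval₂_eq]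
    refine MvPolynomial.totalDegree_finsetSum_le fun d hd => ?_
    refine (MvPolynomial.totalDegree_mul _ _).trans ?_
    rw [MvPolynomial.algebraMap_eq, MvPolynomial.totalDegree_C, zero_add]
    refine (MvPolynomial.totalDegree_finsetProd _ _).trans ?_
    refine (Finset.sum_le_sum fun i _ => ?_).trans (MvPolynomial.le_totalDegree hd)
    refine (MvPolynomial.totalDegree_pow _ _).trans ?_
    rw [MvPolynomial.totalDegree_neg]
    refine (Nat.mul_le_mul_left _ ?_).trans (mul_one _).le
    exact (MvPolynomial.totalDegree_monomial_le (Finsupp.single i 1) (1 : R)).trans (by simp)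
  · rw [← MvPolynomial.coe_aeval_eq_eval, ← MvPolynomial.coe_aeval_eq_eval]
    simp only [RingHom.coe_coe, MvPolynomial.aeval_bind₁, map_neg, MvPolynomial.aeval_X]
    rfl

theorem neg_mem_S2 {x : Fin 3 → ℝ} (hx : x ∈ S2) : -x ∈ S2 := by
  simpa [S2] using hx

theorem PiSph.add_mem {r : ℕ} {p q : (Fin 3 → ℝ) → ℝ} (hp : p ∈ PiSph r) (hq : q ∈ PiSph r) :
    (fun x => p x + q x) ∈ PiSph r := by
  obtain ⟨P, hP, hPx⟩ := hp
  obtain ⟨Q, hQ, hQx⟩ := hq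
  exact ⟨P + Q, (MvPolynomial.totalDegree_add P Q).trans (max_le hP hQ),
    fun x hx => by simp [hPx x hx, hQx x hx]⟩

theorem PiSph.const_mul_mem {r : ℕ} {p : (Fin 3 → ℝ) → ℝ} (c : ℝ) (hp : p ∈ PiSph r) :
    (fun x => c * p x) ∈ PiSph r := by
  obtain ⟨P, hP, hPx⟩ := hp
  exact ⟨c • P, (MvPolynomial.totalDegree_smul_le c P).trans hP,
    fun x hx => by simp [hPx x hx]⟩

theorem PiSph.comp_neg_mem {r : ℕ} {p : (Fin 3 → ℝ) → ℝ} (hp : p ∈ PiSph r) :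
    (fun x => p (-x)) ∈ PiSph r := by
  obtain ⟨P, hP, hPx⟩ := hp
  obtain ⟨Q, hQ, hQx⟩ := P.exists_eval_neg
  exact ⟨Q, hQ.trans hP, fun x hx => (hPx _ (neg_mem_S2 hx)).trans (hQx x).symm⟩

theorem PiSph.evenPart_mem {r : ℕ} {p : (Fin 3 → ℝ) → ℝ} (hp : p ∈ PiSph r) :
    (fun x => (p x + p (-x)) / 2) ∈ PiSph r := by
  convert const_mul_mem (1 / 2) (add_mem hp (comp_neg_mem hp)) using 2
  ring

theorem PiSph.oddPart_mem {r : ℕ} {p : (Fin 3 → ℝ) → ℝ} (hp : p ∈ PiSph r) :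
    (fun x => (p x - p (-x)) / 2) ∈ PiSph r := by
  convert const_mul_mem (1 / 2) (add_mem hp (const_mul_mem (-1) (comp_neg_mem hp))) using 2
  ring

/-- Even and odd functions are orthogonal on a finite symmetric set, so squares add up. -/
theorem Finset.sum_add_sq_of_even_of_odd {G : Type*} [InvolutiveNeg G] {s : Finset G}
    (hs : ∀ x ∈ s, -x ∈ s) {a b : G → ℝ} (ha : ∀ x ∈ s, a (-x) = a x)
    (hb : ∀ x ∈ s, b (-x) = -b x) :
    ∑ x ∈ s, (a x + b x) ^ 2 = ∑ x ∈ s, a x ^ 2 + ∑ x ∈ s, b x ^ 2 := by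
  have h : ∑ x ∈ s, a x * b x = ∑ x ∈ s, -(a x * b x) :=
    Finset.sum_nbij' (fun x => -x) (fun x => -x) hs hs (fun x _ => neg_neg x)
      (fun x _ => neg_neg x) fun x hx => by rw [ha x hx, hb x hx]; ring
  rw [Finset.sum_neg_distrib] at h
  have h0 : ∑ x ∈ s, a x * b x = 0 := by linarith
  simp only [add_sq, mul_assoc, Finset.sum_add_distrib, ← Finset.mul_sum, h0]
  ring

/-- The squared distance of `e + o` to `f` splits into those of `e` and `o` to the even and odd
parts of `f`. -/
theorem Finset.sum_sq_sub_eq_even_add_odd {G : Type*} [InvolutiveNeg G] {s : Finset G}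
    (hs : ∀ x ∈ s, -x ∈ s) {e o : G → ℝ} (f : G → ℝ) (he : ∀ x ∈ s, e (-x) = e x)
    (ho : ∀ x ∈ s, o (-x) = -o x) :
    ∑ x ∈ s, (e x + o x - f x) ^ 2 =
      ∑ x ∈ s, (e x - (f x + f (-x)) / 2) ^ 2 + ∑ x ∈ s, (o x - (f x - f (-x)) / 2) ^ 2 := by
  rw [← Finset.sum_add_sq_of_even_of_odd hs]
  · exact Finset.sum_congr rfl fun x _ => by ring
  · intro x hx
    rw [he x hx, neg_neg]
    ring
  · intro x hx
    rw [ho x hx, neg_neg]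
    ring

/-- In the antipodally symmetric setting, the sum of the even constrained
minimizer (for the even part `f⁺`) and the odd constrained minimizer (for the odd part `f⁻`)
interpolates `f` on `X_M` and minimizes the discrete least squares functional over all
`p ∈ Π_r(S²)` interpolating `f` on `X_M`. -/
theorem parity_decoupling (XN XM : Finset (Fin 3 → ℝ))
    (hXN : ↑XN ⊆ S2) (hsymN : ∀ x ∈ XN, -x ∈ XN)
    (hXM : XM ⊆ XN) (hsymM : ∀ x ∈ XM, -x ∈ XM)
    (r : ℕ) (f pe po : (Fin 3 → ℝ) → ℝ)
    (hpe : pe ∈ PiSph r) (hpeEven : ∀ x ∈ S2, pe (-x) = pe x)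
    (hpo : po ∈ PiSph r) (hpoOdd : ∀ x ∈ S2, po (-x) = -po x)
    (hpeInterp : ∀ x ∈ XM, pe x = (f x + f (-x)) / 2)
    (hpeMin : ∀ p ∈ PiSph r, (∀ x ∈ S2, p (-x) = p x) →
      (∀ x ∈ XM, p x = (f x + f (-x)) / 2) →
      ∑ x ∈ XN, (pe x - (f x + f (-x)) / 2) ^ 2 ≤
        ∑ x ∈ XN, (p x - (f x + f (-x)) / 2) ^ 2)
    (hpoInterp : ∀ x ∈ XM, po x = (f x - f (-x)) / 2)
    (hpoMin : ∀ p ∈ PiSph r, (∀ x ∈ S2, p (-x) = -p x) →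
      (∀ x ∈ XM, p x = (f x - f (-x)) / 2) →
      ∑ x ∈ XN, (po x - (f x - f (-x)) / 2) ^ 2 ≤
        ∑ x ∈ XN, (p x - (f x - f (-x)) / 2) ^ 2) :
    (fun x => pe x + po x) ∈ PiSph r ∧
    (∀ x ∈ XM, pe x + po x = f x) ∧
    (∀ p ∈ PiSph r, (∀ x ∈ XM, p x = f x) →
      ∑ x ∈ XN, (pe x + po x - f x) ^ 2 ≤ ∑ x ∈ XN, (p x - f x) ^ 2) := by
  refine ⟨PiSph.add_mem hpe hpo, fun x hx => ?_, fun p hp hpf => ?_⟩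
  · rw [hpeInterp x hx, hpoInterp x hx]
    ring
  · have hsplit : ∑ x ∈ XN, (p x - f x) ^ 2 =
        ∑ x ∈ XN, ((p x + p (-x)) / 2 - (f x + f (-x)) / 2) ^ 2 +
          ∑ x ∈ XN, ((p x - p (-x)) / 2 - (f x - f (-x)) / 2) ^ 2 := by
      rw [← Finset.sum_sq_sub_eq_even_add_odd (e := fun x => (p x + p (-x)) / 2)
        (o := fun x => (p x - p (-x)) / 2) hsymN f]
      · exact Finset.sum_congr rfl fun x _ => by ring
      · intro x _
        simp only [neg_neg]
        ring
      · intro x _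
        simp only [neg_neg]
        ring
    rw [hsplit, Finset.sum_sq_sub_eq_even_add_odd hsymN f (fun x hx => hpeEven x (hXN hx))
      fun x hx => hpoOdd x (hXN hx)]
    refine add_le_add (hpeMin _ (PiSph.evenPart_mem hp) ?_ ?_) (hpoMin _ (PiSph.oddPart_mem hp) ?_ ?_)
    · intro x _
      simp only [neg_neg]
      ring
    · intro x hx
      simp only [hpf x hx, hpf _ (hsymM x hx)]
    · intro x _
      simp only [neg_neg]
      ring
    · intro x hx
      simp only [hpf x hx, hpf _ (hsymM x hx)]
end
end

section
/- Let Q be a 3×3 real orthogonal matrix, let X_N be a finite set of points on the unit sphere S² ⊂ ℝ³ with Q X_N = X_N, let X_M ⊆ X_N with Q X_M = X_M, let r be a natural number, and let f : S² → ℝ. Suppose p̂ ∈ Π_r(S²) satisfies p̂ = f on X_M and minimizes ∑_{x ∈ X_N} |p(x) − f(x)|² over all p ∈ Π_r(S²) satisfying p = f on X_M. Define f^Q = f ∘ Q⁻¹ and p̂^Q = p̂ ∘ Q⁻¹. Then p̂^Q ∈ Π_r(S²), p̂^Q = f^Q on X_M, and p̂^Q minimizes ∑_{x ∈ X_N} |p(x)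 − f^Q(x)|² over all p ∈ Π_r(S²) satisfying p = f^Q on X_M. -/
open Finset Matrix

noncomputable section

open MvPolynomial in
/-- Substituting polynomials of degree at most one does not increase the total degree. -/
theorem totalDegree_bind₁_le_of_le_one {σ τ R : Type*} [CommSemiring R]
    (g : σ → MvPolynomial τ R) (hg : ∀ i, (g i).totalDegree ≤ 1) (P : MvPolynomial σ R) :
    (bind₁ g P).totalDegree ≤ P.totalDegree := by
  rw [bind₁, aeval_def, eval₂_eq]
  refine totalDegree_finsetSum_le fun d hd => ?_
  refine (totalDegree_mul _ _).trans ?_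
  rw [algebraMap_eq, totalDegree_C, zero_add]
  refine (totalDegree_finsetProd _ _).trans (le_trans ?_ (le_totalDegree hd))
  exact sum_le_sum fun i _ => (totalDegree_pow _ _).trans
    ((Nat.mul_le_mul_left _ (hg i)).trans (mul_one _).le)

theorem mulVec_mem_S2 {A : Matrix (Fin 3) (Fin 3) ℝ} (hA : Aᵀ * A = 1) {x : Fin 3 → ℝ}
    (hx : x ∈ S2) : A *ᵥ x ∈ S2 := by
  have mem_iff (y : Fin 3 → ℝ) : y ∈ S2 ↔ y ⬝ᵥ y = 1 := by
    simp only [S2, Set.mem_ofPred_eq, dotProduct, sq]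
  rw [mem_iff] at hx ⊢
  rw [dotProduct_mulVec, ← mulVec_transpose, mulVec_mulVec, hA, one_mulVec, hx]

theorem comp_mulVec_mem_PiSph {A : Matrix (Fin 3) (Fin 3) ℝ} (hA : Aᵀ * A = 1) {r : ℕ}
    {p : (Fin 3 → ℝ) → ℝ} (hp : p ∈ PiSph r) : (fun x => p (A *ᵥ x)) ∈ PiSph r := by
  obtain ⟨P, hP, hpP⟩ := hp
  let g : Fin 3 → MvPolynomial (Fin 3) ℝ := fun i => ∑ j, A i j • MvPolynomial.X j
  have hg (i : Fin 3) : (g i).totalDegree ≤ 1 :=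
    MvPolynomial.totalDegree_finsetSum_le fun j _ =>
      (MvPolynomial.totalDegree_smul_le _ _).trans (MvPolynomial.totalDegree_X j).le
  refine ⟨MvPolynomial.bind₁ g P, (totalDegree_bind₁_le_of_le_one g hg P).trans hP,
    fun x hx => ?_⟩
  have heval : (fun i => MvPolynomial.eval x (g i)) = A *ᵥ x := by
    ext i
    simp [g, mulVec, dotProduct]
  refine (hpP _ (mulVec_mem_S2 hA hx)).trans ?_
  rw [← heval]
  exact (MvPolynomial.eval₂Hom_bind₁ _ _ _ _).symm

/-- Equivariance under an orthogonal transformation `Q` preserving both node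
sets: if `p̂` is the constrained minimizer for `f`, then `p̂^Q = p̂ ∘ Q⁻¹` belongs to `Π_r(S²)`,
interpolates `f^Q = f ∘ Q⁻¹` on `X_M`, and is a constrained minimizer for `f^Q`. -/
theorem orthogonal_equivariance (Q : Matrix (Fin 3) (Fin 3) ℝ) (hQ : Qᵀ * Q = 1)
    (XN XM : Finset (Fin 3 → ℝ))
    (hXN : ↑XN ⊆ S2) (hXM : XM ⊆ XN)
    (hQXN : XN.image (fun x => Q.mulVec x) = XN)
    (hQXM : XM.image (fun x => Q.mulVec x) = XM)
    (r : ℕ) (f phat : (Fin 3 → ℝ) → ℝ)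
    (hphat : phat ∈ PiSph r)
    (hinterp : ∀ x ∈ XM, phat x = f x)
    (hmin : ∀ p ∈ PiSph r, (∀ x ∈ XM, p x = f x) →
      ∑ x ∈ XN, (phat x - f x) ^ 2 ≤ ∑ x ∈ XN, (p x - f x) ^ 2) :
    (fun x => phat (Q⁻¹.mulVec x)) ∈ PiSph r ∧
    (∀ x ∈ XM, phat (Q⁻¹.mulVec x) = f (Q⁻¹.mulVec x)) ∧
    (∀ p ∈ PiSph r, (∀ x ∈ XM, p x = f (Q⁻¹.mulVec x)) →
      ∑ x ∈ XN, (phat (Q⁻¹.mulVec x) - f (Q⁻¹.mulVec x)) ^ 2 ≤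
        ∑ x ∈ XN, (p x - f (Q⁻¹.mulVec x)) ^ 2) := by
  have hQ' : Q * Qᵀ = 1 := mul_eq_one_comm.mp hQ
  have hinv : Q⁻¹ = Qᵀ := inv_eq_left_inv hQ
  have hcancel (x : Fin 3 → ℝ) : Q⁻¹ *ᵥ (Q *ᵥ x) = x := by
    rw [hinv, mulVec_mulVec, hQ, one_mulVec]
  have hinj : Function.Injective fun x => Q *ᵥ x := Function.LeftInverse.injective hcancel
  have hsum (F : (Fin 3 → ℝ) → ℝ) : ∑ x ∈ XN, F x = ∑ x ∈ XN, F (Q *ᵥ x) := by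
    conv_lhs => rw [← hQXN]
    exact sum_image hinj.injOn
  refine ⟨comp_mulVec_mem_PiSph (by rw [hinv, transpose_transpose, hQ']) hphat,
    fun x hx => hinterp _ ?_, fun p hp hpf => ?_⟩
  · rw [← hQXM] at hx
    obtain ⟨y, hy, rfl⟩ := mem_image.mp hx
    rwa [hcancel]
  · rw [hsum, hsum fun x => (p x - f (Q⁻¹ *ᵥ x)) ^ 2]
    simp only [hcancel]
    refine hmin _ (comp_mulVec_mem_PiSph hQ hp) fun x hx => ?_
    rw [hpf _ (hQXM ▸ mem_image_of_mem _ hx), hcancel]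
end
end

section
/- Let R, M be natural numbers with M < R, let α > 0 be a real number, and let B be a real M×R matrix with rank(B) = M. Let β denote the largest and γ the smallest eigenvalue of the symmetric positive definite matrix B Bᵀ. Then the spectral condition number of the symmetric block matrix K = [[α·I_R, Bᵀ], [B, 0]] satisfies κ₂(K) = [(α + √(α² + 4β))/2] / min{ α, (√(α² + 4γ) − α)/2 }, where κ₂(K) is the ratio of the largest to the smallest absolute value of an eigenvalue of K. -/
open Matrix Polynomial

/-- The KKT matrix `K = [[α·I_R, Bᵀ], [B, 0]]` arising for spherical designs. -/
noncomputable def Kmat (R M : ℕ) (α : ℝ) (B : Matrix (Fin M) (Fin R) ℝ) :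
    Matrix (Fin R ⊕ Fin M) (Fin R ⊕ Fin M) ℝ :=
  Matrix.fromBlocks (α • (1 : Matrix (Fin R) (Fin R) ℝ)) Bᵀ B 0

/-- The roots of the characteristic polynomial are the eigenvalues. -/
theorem mem_roots_charpoly_iff_exists_mulVec {n : Type*} [Fintype n] [DecidableEq n]
    (A : Matrix n n ℝ) (t : ℝ) :
    t ∈ A.charpoly.roots ↔ ∃ x : n → ℝ, x ≠ 0 ∧ A *ᵥ x = t • x := by
  rw [Polynomial.mem_roots A.charpoly_monic.ne_zero, Polynomial.IsRoot.def, Matrix.eval_charpoly,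
    ← Matrix.exists_mulVec_eq_zero_iff]
  refine exists_congr fun x => and_congr_right fun _ => ?_
  rw [Matrix.sub_mulVec, sub_eq_zero, eq_comm]
  simp [Matrix.scalar_apply, ← Matrix.smul_one_eq_diagonal, Matrix.smul_mulVec]

/-- If `B` has full row rank, every eigenvalue of `B Bᵀ` is positive. -/
theorem pos_of_mem_roots_charpoly_mul_transpose {R M : ℕ} {B : Matrix (Fin M) (Fin R) ℝ}
    (hB : B.rank = M) {t : ℝ} (ht : t ∈ (B * Bᵀ).charpoly.roots) : 0 < t := by
  obtain ⟨y, hy, hyt⟩ := (mem_roots_charpoly_iff_exists_mulVec _ _).1 ht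
  have hinj : Bᵀ *ᵥ y ≠ 0 := by
    intro h
    have hli : LinearIndependent ℝ B.row := by
      rw [linearIndependent_iff_card_eq_finrank_span, Set.finrank, ← Matrix.rank_eq_finrank_span_row,
        hB, Fintype.card_fin]
    rw [← Matrix.vecMul_injective_iff] at hli
    exact hy (hli (by simpa [Matrix.mulVec_transpose] using h))
  have hpos : 0 < (Bᵀ *ᵥ y) ⬝ᵥ (Bᵀ *ᵥ y) :=
    lt_of_le_of_ne (Finset.sum_nonneg fun i _ => mul_self_nonneg _)
      fun h => hinj (dotProduct_self_eq_zero.1 h.symm)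
  have hypos : 0 < y ⬝ᵥ y :=
    lt_of_le_of_ne (Finset.sum_nonneg fun i _ => mul_self_nonneg _)
      fun h => hy (dotProduct_self_eq_zero.1 h.symm)
  have hquad : (Bᵀ *ᵥ y) ⬝ᵥ (Bᵀ *ᵥ y) = t * (y ⬝ᵥ y) := by
    rw [← smul_eq_mul, ← dotProduct_smul, ← hyt, ← Matrix.mulVec_mulVec,
      Matrix.dotProduct_mulVec y B, Matrix.mulVec_transpose]
  rw [hquad] at hpos
  exact pos_of_mul_pos_left hpos hypos.le

theorem Kmat_mulVec_elim (R M : ℕ) (α : ℝ) (B : Matrix (Fin M) (Fin R) ℝ)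
    (x : Fin R → ℝ) (y : Fin M → ℝ) :
    Kmat R M α B *ᵥ Sum.elim x y = Sum.elim (α • x + Bᵀ *ᵥ y) (B *ᵥ x) := by
  simp [Kmat, Matrix.fromBlocks_mulVec, Matrix.smul_mulVec]

/-- The eigenvalues of `K` are `α` and the solutions `t` of `t² - α t = ν`, with `ν` ranging over
the eigenvalues of `B Bᵀ`. -/
theorem mem_roots_charpoly_Kmat_iff {R M : ℕ} (hMR : M < R) (α : ℝ)
    {B : Matrix (Fin M) (Fin R) ℝ} (hB : B.rank = M) (t : ℝ) :
    t ∈ (Kmat R M α B).charpoly.roots ↔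
      t = α ∨ t ^ 2 - α * t ∈ (B * Bᵀ).charpoly.roots := by
  constructor
  · rw [mem_roots_charpoly_iff_exists_mulVec, mem_roots_charpoly_iff_exists_mulVec]
    rintro ⟨z, hz, hzt⟩
    obtain ⟨x, y, rfl⟩ : ∃ x y, z = Sum.elim x y := ⟨_, _, (Sum.elim_comp_inl_inr z).symm⟩
    rw [Kmat_mulVec_elim] at hzt
    have hx : α • x + Bᵀ *ᵥ y = t • x := by
      ext i; simpa using congrFun hzt (Sum.inl i)
    have hy : B *ᵥ x = t • y := by
      ext i; simpa using congrFun hzt (Sum.inr i)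
    refine or_iff_not_imp_left.2 fun hne => ⟨y, ?_, ?_⟩
    · rintro rfl
      apply hz
      have h0 : (t - α) • x = 0 := by
        rw [sub_smul, ← hx]; simp
      rw [(smul_eq_zero.1 h0).resolve_left (sub_ne_zero.2 hne)]
      ext i; cases i <;> rfl
    · have hBy : Bᵀ *ᵥ y = (t - α) • x := by
        rw [sub_smul, ← hx]; simp
      rw [← Matrix.mulVec_mulVec, hBy, Matrix.mulVec_smul, hy, smul_smul]
      congr 1; ring
  · rintro (rfl | ht)
    · obtain ⟨x, hxB, hx⟩ := (Submodule.ne_bot_iff _).1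
        (LinearMap.ker_ne_bot_of_finrank_lt (f := B.mulVecLin) (by simpa using hMR))
      rw [LinearMap.mem_ker, Matrix.mulVecLin_apply] at hxB
      refine (mem_roots_charpoly_iff_exists_mulVec _ _).2 ⟨Sum.elim x 0, fun h => hx ?_, ?_⟩
      · ext i; exact congrFun h (Sum.inl i)
      · rw [Kmat_mulVec_elim]
        ext i; cases i <;> simp [hxB]
    · have hpos := pos_of_mem_roots_charpoly_mul_transpose hB ht
      obtain ⟨y, hy, hyt⟩ := (mem_roots_charpoly_iff_exists_mulVec _ _).1 ht
      rw [← Matrix.mulVec_mulVec] at hyt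
      refine (mem_roots_charpoly_iff_exists_mulVec _ _).2
        ⟨Sum.elim (Bᵀ *ᵥ y) ((t - α) • y), fun h => ?_, ?_⟩
      · have h0 : Bᵀ *ᵥ y = 0 := by
          ext i; exact congrFun h (Sum.inl i)
        rw [h0, Matrix.mulVec_zero] at hyt
        exact (smul_ne_zero hpos.ne' hy) hyt.symm
      · rw [Kmat_mulVec_elim, hyt, Matrix.mulVec_smul]
        ext i
        cases i <;> simp <;> ring

/-- Let `M < R`, `α > 0` and `rank B = M`, and let `β` (resp. `γ`) be the
largest (resp. smallest) eigenvalue of `B Bᵀ`. Then the spectral condition number of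
`K = [[α·I_R, Bᵀ], [B, 0]]` — the ratio of the largest to the smallest absolute value of an
eigenvalue of `K` — equals
`[(α + √(α² + 4β))/2] / min{α, (√(α² + 4γ) − α)/2}`. -/
theorem kkt_design_condition_number (R M : ℕ) (hMR : M < R) (α : ℝ) (hα : 0 < α)
    (B : Matrix (Fin M) (Fin R) ℝ) (hB : B.rank = M)
    (β γ : ℝ)
    (hβmem : β ∈ (B * Bᵀ).charpoly.roots)
    (hβmax : ∀ ν ∈ (B * Bᵀ).charpoly.roots, ν ≤ β)
    (hγmem : γ ∈ (B * Bᵀ).charpoly.roots)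
    (hγmin : ∀ ν ∈ (B * Bᵀ).charpoly.roots, γ ≤ ν)
    (u v : ℝ)
    (hu : u ∈ (Kmat R M α B).charpoly.roots.map (fun t => |t|))
    (humax : ∀ t ∈ (Kmat R M α B).charpoly.roots.map (fun t => |t|), t ≤ u)
    (hv : v ∈ (Kmat R M α B).charpoly.roots.map (fun t => |t|))
    (hvmin : ∀ t ∈ (Kmat R M α B).charpoly.roots.map (fun t => |t|), v ≤ t) :
    u / v = ((α + Real.sqrt (α ^ 2 + 4 * β)) / 2) /
      min α ((Real.sqrt (α ^ 2 + 4 * γ) - α) / 2) := by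
  have hγpos := pos_of_mem_roots_charpoly_mul_transpose hB hγmem
  have hβpos := pos_of_mem_roots_charpoly_mul_transpose hB hβmem
  have hK := mem_roots_charpoly_Kmat_iff hMR α hB
  simp only [Multiset.mem_map] at hu hv humax hvmin
  have hsβ := Real.sq_sqrt (show 0 ≤ α ^ 2 + 4 * β by positivity)
  have hsγ := Real.sq_sqrt (show 0 ≤ α ^ 2 + 4 * γ by positivity)
  have hβα : α < √(α ^ 2 + 4 * β) := Real.lt_sqrt_of_sq_lt (by linarith)
  have hγα : α < √(α ^ 2 + 4 * γ) := Real.lt_sqrt_of_sq_lt (by linarith)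
  set b := √(α ^ 2 + 4 * β)
  set c := √(α ^ 2 + 4 * γ)
  have hu' : u = (α + b) / 2 := by
    apply le_antisymm
    · obtain ⟨t, ht, rfl⟩ := hu
      rcases (hK t).1 ht with rfl | ht
      · rw [abs_of_pos hα]; linarith
      · have hle := hβmax _ ht
        rw [abs_le]
        constructor <;> nlinarith
    · refine humax _ ⟨(α + b) / 2, (hK _).2 (Or.inr ?_), abs_of_pos (by linarith)⟩
      convert hβmem using 1
      linarith
  have hv' : v = min α ((c - α) / 2) := by
    apply le_antisymm
    · refine le_min (hvmin _ ⟨α, (hK _).2 (Or.inl rfl), abs_of_pos hα⟩)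
        (hvmin _ ⟨(α - c) / 2, (hK _).2 (Or.inr ?_), ?_⟩)
      · convert hγmem using 1
        linarith
      · rw [abs_of_neg (by linarith)]; ring
    · obtain ⟨t, ht, rfl⟩ := hv
      rcases (hK t).1 ht with rfl | ht
      · rw [abs_of_pos hα]; exact min_le_left _ _
      · have hle := hγmin _ ht
        rcases le_total 0 t with h0 | h0
        · refine (min_le_left _ _).trans ?_
          rw [abs_of_nonneg h0]
          nlinarith
        · refine (min_le_right _ _).trans ?_
          rw [abs_of_nonpos h0]
          nlinarith
  rw [hu', hv']
end

section
/- Let X_N be a finite set of points on the unit sphere S² ⊂ ℝ³, let X_M ⊆ X_N, let m ≤ r be natural numbers, and let f : S² → ℝ. Suppose p̂ ∈ Π_r(S²) satisfies p̂ = f on X_M and minimizes ∑_{x ∈ X_N} |p(x) − f(x)|² over all p ∈ Π_r(S²) satisfying p = f on X_M, and suppose g ∈ Π_m(S²) satisfies g(x) = f(x) for all x ∈ X_M. Then the Pythagorean identity ‖f − p̂‖²_{2,X_N} + ‖p̂ − g‖²_{2,X_N} = ‖f − g‖²_{2,X_N} holds, where ‖h‖²_{2,X_N} = ∑_{x ∈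 X_N} |h(x)|². -/
open Finset

noncomputable section

/-- `Π_r(S²)` is closed under affine combinations of two elements. -/
theorem add_smul_sub_mem_PiSph {r : ℕ} {p q : (Fin 3 → ℝ) → ℝ} (hp : p ∈ PiSph r)
    (hq : q ∈ PiSph r) (t : ℝ) : (fun x => p x + t * (q x - p x)) ∈ PiSph r := by
  obtain ⟨P, hP, hpP⟩ := hp
  obtain ⟨Q, hQ, hqQ⟩ := hq
  refine ⟨P + t • (Q - P), ?_, fun x hx => ?_⟩
  · exact (MvPolynomial.totalDegree_add _ _).trans <| max_le hP <|
      (MvPolynomial.totalDegree_smul_le _ _).trans <|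
        (MvPolynomial.totalDegree_sub _ _).trans (max_le hQ hP)
  · simp [hpP x hx, hqQ x hx, MvPolynomial.smul_eval]

/-- The spaces `Π_r(S²)` increase with `r`. -/
theorem PiSph_mono {m r : ℕ} (h : m ≤ r) : PiSph m ⊆ PiSph r :=
  fun _ ⟨P, hP, hpP⟩ => ⟨P, hP.trans h, hpP⟩

/-- If `u` has least discrete 2-norm on the line `u + t v`, then `u` is orthogonal to `v`. -/
theorem sum_mul_eq_zero_of_forall_sum_sq_le {ι : Type*} (s : Finset ι) (u v : ι → ℝ)
    (h : ∀ t : ℝ, ∑ x ∈ s, u x ^ 2 ≤ ∑ x ∈ s, (u x + t * v x) ^ 2) :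
    ∑ x ∈ s, u x * v x = 0 := by
  have hexp (t : ℝ) : ∑ x ∈ s, (u x + t * v x) ^ 2 =
      ∑ x ∈ s, u x ^ 2 + 2 * t * ∑ x ∈ s, u x * v x + t ^ 2 * ∑ x ∈ s, v x ^ 2 := by
    simp only [Finset.mul_sum, ← Finset.sum_add_distrib]
    exact Finset.sum_congr rfl fun x _ => by ring
  have hdiscrim := discrim_le_zero (a := ∑ x ∈ s, v x ^ 2) (b := 2 * ∑ x ∈ s, u x * v x) (c := 0)
    fun t => by linarith [h t, hexp t]
  rw [discrim] at hdiscrim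
  exact pow_eq_zero_iff two_ne_zero |>.mp (le_antisymm (by linarith) (sq_nonneg _))

/-- Pythagorean identity: if `p̂ ∈ Π_r(S²)` is the constrained minimizer and
`g ∈ Π_m(S²)` (`m ≤ r`) interpolates `f` on `X_M`, then
`‖f − p̂‖²_{2,X_N} + ‖p̂ − g‖²_{2,X_N} = ‖f − g‖²_{2,X_N}`. -/
theorem pythagorean_identity (XN XM : Finset (Fin 3 → ℝ))
    (hXN : ↑XN ⊆ S2) (hXM : XM ⊆ XN)
    (m r : ℕ) (hmr : m ≤ r)
    (f phat g : (Fin 3 → ℝ) → ℝ)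
    (hphat : phat ∈ PiSph r)
    (hinterp : ∀ x ∈ XM, phat x = f x)
    (hmin : ∀ p ∈ PiSph r, (∀ x ∈ XM, p x = f x) →
      ∑ x ∈ XN, (phat x - f x) ^ 2 ≤ ∑ x ∈ XN, (p x - f x) ^ 2)
    (hg : g ∈ PiSph m)
    (hginterp : ∀ x ∈ XM, g x = f x) :
    ∑ x ∈ XN, (f x - phat x) ^ 2 + ∑ x ∈ XN, (phat x - g x) ^ 2
      = ∑ x ∈ XN, (f x - g x) ^ 2 := by
  have horth : ∑ x ∈ XN, (phat x - f x) * (g x - phat x) = 0 := by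
    refine sum_mul_eq_zero_of_forall_sum_sq_le XN _ _ fun t => ?_
    refine (hmin _ (add_smul_sub_mem_PiSph hphat (PiSph_mono hmr hg) t) fun x hx => ?_).trans_eq ?_
    · simp [hinterp x hx, hginterp x hx]
    · exact Finset.sum_congr rfl fun x _ => by ring
  have hexp : ∑ x ∈ XN, (f x - g x) ^ 2 = ∑ x ∈ XN, (f x - phat x) ^ 2 +
      ∑ x ∈ XN, (phat x - g x) ^ 2 + 2 * ∑ x ∈ XN, (phat x - f x) * (g x - phat x) := by
    simp only [Finset.mul_sum, ← Finset.sum_add_distrib]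
    exact Finset.sum_congr rfl fun x _ => by ring
  rw [hexp, horth, mul_zero, add_zero]
end
end
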